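/- Delay Gronwall inequality (Bainov–Simeonov): Let t₀ ∈ ℝ, n ∈ ℕ with n ≥ 1, h₁, …, hₙ > 0 and h = max{h₁, …, hₙ}. Let g : [t₀, ∞) → [0, ∞) be continuous and nondecreasing, let b, c₁, …, cₙ : [t₀, ∞) → [0, ∞) be continuous, and let ψ : [t₀ - h, t₀] → [0, ∞) be continuous. Suppose u : [t₀ - h, ∞) → [0, ∞) is continuous, u(t) = ψ(t) for t ∈ [t₀ - h, t₀], and u(t) ≤ g(t) + ∫_{t₀}^t b(s) u(s) ds + ∑_{i=1}^n ∫_{t₀}^t c_i(s) u(s - h_i) ds for all t ≥ t₀. Then for all t ≥ t₀, u(t) ≤ [ g(t) + ∑_{i=1}^n ∫_{t₀}^{min(t, t₀ + h_i)} c_i(s) ψ(s - h_i) ds ] · exp( ∫_{t₀}^t b(s) ds + ∑_{i=1}^n ∫_{min(t, t₀ + h_i)}^{t} c_i(s) ds ). -/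

import Mathlib

open MeasureTheory

/-- An integral from `min t τ` to `t` only sees the integrand on `[τ, ∞)`. -/
theorem integral_min_eq_integral_max_comp_max (f : ℝ → ℝ) (τ t : ℝ) :
    ∫ s in min t τ..t, f s = ∫ s in τ..max t τ, f (max s τ) := by
  rcases le_total t τ with h | h
  · simp [h]
  · rw [min_eq_right h, max_eq_left h]
    refine intervalIntegral.integral_congr fun s hs => ?_
    rw [Set.uIcc_of_le h] at hs
    simp [max_eq_left hs.1]

theorem continuous_comp_max {f : ℝ → ℝ} {τ : ℝ} (hf : ContinuousOn f (Set.Ici τ)) :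
    Continuous fun s => f (max s τ) :=
  hf.comp_continuous (by fun_prop) fun s => le_max_right s τ

theorem continuous_integral_min {f : ℝ → ℝ} {τ : ℝ} (hf : ContinuousOn f (Set.Ici τ)) :
    Continuous fun t => ∫ s in min t τ..t, f s := by
  simp only [integral_min_eq_integral_max_comp_max f τ]
  have hc := continuous_comp_max hf
  exact (intervalIntegral.continuous_primitive (fun a b => hc.intervalIntegrable a b) τ).comp
    (continuous_id.max continuous_const)

theorem monotone_integral_min {f : ℝ → ℝ} {τ : ℝ} (hf : ContinuousOn f (Set.Ici τ))
    (hf0 : ∀ t ∈ Set.Ici τ, 0 ≤ f t) : Monotone fun t => ∫ s in min t τ..t, f s := by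
  intro x y hxy
  simp only [integral_min_eq_integral_max_comp_max f τ]
  have hc := continuous_comp_max hf
  exact intervalIntegral.integral_mono_interval le_rfl (le_max_right x τ)
    (max_le_max_right τ hxy) (Filter.Eventually.of_forall fun s => hf0 _ (le_max_right s τ))
    (hc.intervalIntegrable _ _)

theorem hasDerivWithinAt_integral_min {f : ℝ → ℝ} {τ : ℝ} (hf : ContinuousOn f (Set.Ici τ))
    (t : ℝ) :
    HasDerivWithinAt (fun t => ∫ s in min t τ..t, f s) (if t < τ then 0 else f t)
      (Set.Ici t) t := by
  simp only [integral_min_eq_integral_max_comp_max f τ]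
  have hc := continuous_comp_max hf
  split_ifs with h
  · refine (HasDerivAt.congr_of_eventuallyEq (hasDerivAt_const t (0 : ℝ)) ?_).hasDerivWithinAt
    filter_upwards [Iio_mem_nhds h] with s hs
    simp [max_eq_right (Set.mem_Iio.1 hs).le]
  · push Not at h
    have hd := intervalIntegral.integral_hasDerivAt_right (hc.intervalIntegrable τ t)
      (hc.stronglyMeasurableAtFilter _ _) hc.continuousAt
    rw [max_eq_left h] at hd
    refine hd.hasDerivWithinAt.congr (fun s hs => ?_) ?_
    · rw [max_eq_left (h.trans hs)]
    · rw [max_eq_left h]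

/-- Differential Gronwall inequality with right derivatives and a nonautonomous rate. -/
theorem le_mul_exp_sub_of_deriv_right_le {V V' A A' : ℝ → ℝ} {a T : ℝ} (haT : a ≤ T)
    (hV : ContinuousOn V (Set.Icc a T)) (hA : ContinuousOn A (Set.Icc a T))
    (hV' : ∀ t ∈ Set.Ico a T, HasDerivWithinAt V (V' t) (Set.Ici t) t)
    (hA' : ∀ t ∈ Set.Ico a T, HasDerivWithinAt A (A' t) (Set.Ici t) t)
    (hle : ∀ t ∈ Set.Ico a T, V' t ≤ A' t * V t) :
    V T ≤ V a * Real.exp (A T - A a) := by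
  have key := image_le_of_deriv_right_le_deriv_boundary
    (f := fun t => V t * Real.exp (-A t)) (B := fun _ => V a * Real.exp (-A a))
    (B' := fun _ => 0) (hV.mul hA.neg.rexp) (fun t ht => (hV' t ht).mul (hA' t ht).neg.exp)
    le_rfl continuousOn_const (fun t _ => hasDerivWithinAt_const _ _ _)
    (fun t ht => by
      simp only [Pi.neg_apply]
      nlinarith [mul_nonneg (sub_nonneg.2 (hle t ht)) (Real.exp_nonneg (-A t))])
    (Set.right_mem_Icc.2 haT)
  have h2 := mul_le_mul_of_nonneg_right key (Real.exp_nonneg (A T))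
  simp only [mul_assoc, ← Real.exp_add] at h2
  simpa [sub_eq_neg_add] using h2

/-- Delay Gronwall inequality (Bainov–Simeonov). -/
theorem delay_gronwall (t₀ : ℝ) (n : ℕ) (hn : 1 ≤ n) (h : Fin n → ℝ) (hh : ∀ i, 0 < h i)
    (H : ℝ) (hHub : ∀ i, h i ≤ H) (hHmem : ∃ i, h i = H)
    (g b : ℝ → ℝ) (c : Fin n → ℝ → ℝ) (ψ u : ℝ → ℝ)
    (hg_cont : ContinuousOn g (Set.Ici t₀)) (hg_mono : MonotoneOn g (Set.Ici t₀))
    (hg_nonneg : ∀ t ∈ Set.Ici t₀, 0 ≤ g t)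
    (hb_cont : ContinuousOn b (Set.Ici t₀)) (hb_nonneg : ∀ t ∈ Set.Ici t₀, 0 ≤ b t)
    (hc_cont : ∀ i, ContinuousOn (c i) (Set.Ici t₀))
    (hc_nonneg : ∀ i, ∀ t ∈ Set.Ici t₀, 0 ≤ c i t)
    (hψ_cont : ContinuousOn ψ (Set.Icc (t₀ - H) t₀))
    (hψ_nonneg : ∀ t ∈ Set.Icc (t₀ - H) t₀, 0 ≤ ψ t)
    (hu_cont : ContinuousOn u (Set.Ici (t₀ - H)))
    (hu_nonneg : ∀ t ∈ Set.Ici (t₀ - H), 0 ≤ u t)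
    (hu_init : ∀ t ∈ Set.Icc (t₀ - H) t₀, u t = ψ t)
    (hu_ineq : ∀ t, t₀ ≤ t →
      u t ≤ g t + (∫ s in t₀..t, b s * u s) + ∑ i, ∫ s in t₀..t, c i s * u (s - h i)) :
    ∀ t, t₀ ≤ t →
      u t ≤ (g t + ∑ i, ∫ s in t₀..min t (t₀ + h i), c i s * ψ (s - h i)) *
        Real.exp ((∫ s in t₀..t, b s) + ∑ i, ∫ s in min t (t₀ + h i)..t, c i s) := by
  intro T hT
  have hcu (i : Fin n) :
      ContinuousOn (fun s => c i s * u (s - h i)) (Set.Ici t₀) :=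
    (hc_cont i).mul (hu_cont.comp (by fun_prop) fun s hs => by
      have := hHub i
      simp only [Set.mem_Ici] at hs ⊢
      linarith)
  have hsub (i : Fin n) : Set.Ici (t₀ + h i) ⊆ Set.Ici t₀ :=
    Set.Ici_subset_Ici.2 (by linarith [hh i])
  have hH : 0 < H := by
    obtain ⟨i, rfl⟩ := hHmem
    exact hh i
  have hbu : ContinuousOn (fun s => b s * u s) (Set.Ici t₀) :=
    hb_cont.mul (hu_cont.mono (Set.Ici_subset_Ici.2 (by linarith)))
  have hbu0 : ∀ t ∈ Set.Ici t₀, 0 ≤ b t * u t := fun t ht =>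
    mul_nonneg (hb_nonneg t ht) (hu_nonneg t (by simp only [Set.mem_Ici] at ht ⊢; linarith))
  have hcu0 (i : Fin n) : ∀ t ∈ Set.Ici t₀, 0 ≤ c i t * u (t - h i) := fun t ht =>
    mul_nonneg (hc_nonneg i t ht)
      (hu_nonneg _ (by have := hHub i; simp only [Set.mem_Ici] at ht ⊢; linarith))
  have hint (i : Fin n) {x y : ℝ} (hx : t₀ ≤ x) (hy : t₀ ≤ y) :
      IntervalIntegrable (fun s => c i s * u (s - h i)) volume x y :=
    ((hcu i).mono fun s hs => (le_min hx hy).trans hs.1).intervalIntegrable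
  have hmin (i : Fin n) {t : ℝ} (ht : t₀ ≤ t) : t₀ ≤ min t (t₀ + h i) :=
    le_min ht (by linarith [hh i])
  have hhist (i : Fin n) {t : ℝ} (ht : t₀ ≤ t) :
      ∫ s in t₀..min t (t₀ + h i), c i s * ψ (s - h i)
        = ∫ s in t₀..min t (t₀ + h i), c i s * u (s - h i) := by
    refine intervalIntegral.integral_congr fun s hs => ?_
    rw [Set.uIcc_of_le (hmin i ht)] at hs
    have h1 := hs.2.trans (min_le_right _ _)
    have h2 := hs.1
    have h3 := hHub i
    rw [hu_init (s - h i) ⟨by linarith, by linarith⟩]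
  set K := g T + ∑ i, ∫ s in t₀..min T (t₀ + h i), c i s * ψ (s - h i) with hK
  let V : ℝ → ℝ := fun t => K + (∫ s in min t t₀..t, b s * u s)
    + ∑ i, ∫ s in min t (t₀ + h i)..t, c i s * u (s - h i)
  let A : ℝ → ℝ := fun t => (∫ s in min t t₀..t, b s)
    + ∑ i, ∫ s in min t (t₀ + h i)..t, c i s
  have hV_mono : Monotone V := fun x y hxy =>
    add_le_add (add_le_add le_rfl (monotone_integral_min hbu hbu0 hxy))
      (Finset.sum_le_sum fun i _ => monotone_integral_min ((hcu i).mono (hsub i))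
        (fun t ht => hcu0 i t (hsub i ht)) hxy)
  have huV : ∀ t ∈ Set.Icc t₀ T, u t ≤ V t := by
    rintro t ⟨ht, htT⟩
    have hsum : ∑ i, ∫ s in t₀..t, c i s * u (s - h i)
        ≤ ∑ i, ((∫ s in t₀..min T (t₀ + h i), c i s * ψ (s - h i))
          + ∫ s in min t (t₀ + h i)..t, c i s * u (s - h i)) := by
      refine Finset.sum_le_sum fun i _ => ?_
      rw [← intervalIntegral.integral_add_adjacent_intervals (hint i le_rfl (hmin i ht))
        (hint i (hmin i ht) ht), hhist i hT]
      gcongr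
      refine intervalIntegral.integral_mono_interval le_rfl (hmin i ht)
        (min_le_min_right _ htT) ?_ (hint i le_rfl (hmin i hT))
      filter_upwards [ae_restrict_mem measurableSet_Ioc] with s hs
      exact hcu0 i s hs.1.le
    rw [Finset.sum_add_distrib] at hsum
    have h1 := hu_ineq t ht
    have h2 := hg_mono ht hT htT
    simp only [V, hK, min_eq_right ht]
    linarith
  have hfinal := le_mul_exp_sub_of_deriv_right_le (V := V) (A := A) hT
    (((continuous_const.add (continuous_integral_min hbu)).add
      (continuous_finsetSum _ fun i _ =>
        continuous_integral_min ((hcu i).mono (hsub i)))).continuousOn)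
    (((continuous_integral_min hb_cont).add (continuous_finsetSum _ fun i _ =>
        continuous_integral_min ((hc_cont i).mono (hsub i)))).continuousOn)
    (fun t _ => ((hasDerivWithinAt_integral_min hbu t).const_add K).add
      (HasDerivWithinAt.fun_sum fun i _ =>
        hasDerivWithinAt_integral_min ((hcu i).mono (hsub i)) t))
    (fun t _ => (hasDerivWithinAt_integral_min hb_cont t).add
      (HasDerivWithinAt.fun_sum fun i _ =>
        hasDerivWithinAt_integral_min ((hc_cont i).mono (hsub i)) t))
    (by
      rintro t ⟨ht, htT⟩
      rw [add_mul, Finset.sum_mul, if_neg ht.not_gt, if_neg ht.not_gt]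
      refine add_le_add (mul_le_mul_of_nonneg_left (huV t ⟨ht, htT.le⟩) (hb_nonneg t ht))
        (Finset.sum_le_sum fun i _ => ?_)
      split_ifs with hi
      · simp
      · have h0 := hh i
        exact mul_le_mul_of_nonneg_left ((huV (t - h i) ⟨by linarith, by linarith⟩).trans
          (hV_mono (by linarith))) (hc_nonneg i t ht))
  have hmin0 (i : Fin n) : min t₀ (t₀ + h i) = t₀ := min_eq_left (by linarith [hh i])
  have hVt₀ : V t₀ = K := by simp [V, hmin0]
  have hAt₀ : A t₀ = 0 := by simp [A, hmin0]
  rw [hVt₀, hAt₀, sub_zero] at hfinal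
  simp only [A, min_eq_right hT] at hfinal
  exact (huV T ⟨hT, le_rfl⟩).trans hfinal
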